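/- For every prime p, the lower asymptotic density δ̲_p := liminf_{x→∞} #{primes q with p < q ≤ x such that there exists a prime r > q with A(pqr) > (p+1)/2} / π(x) satisfies δ̲_p ≥ #𝓑(p)/(p−1), where π(x) denotes the number of primes up to x. -/

import Mathlib

/-- The inverse of `b` modulo `p`, normalized to lie in `[0, p-1]`. -/
def modInv (p b : ℕ) : ℕ := ((b : ZMod p)⁻¹).val

/-- The set `𝓑₋(p)` of integers `β` with `1 ≤ β ≤ (p-3)/2`, `p ≤ β + 2β̄ + 1` and `β > β̄`. -/
def Bminus (p : ℕ) : Finset ℕ :=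
  (Finset.Icc 1 p).filter fun β =>
    2 * β + 3 ≤ p ∧ p ≤ β + 2 * modInv p β + 1 ∧ modInv p β < β

/-- The set `𝓑₊(p)` of integers `β` with `1 ≤ β ≤ (p-3)/2`, `β + β̄ ≥ p` and `β̄ ≤ 2β`. -/
def Bplus (p : ℕ) : Finset ℕ :=
  (Finset.Icc 1 p).filter fun β =>
    2 * β + 3 ≤ p ∧ p ≤ β + modInv p β ∧ modInv p β ≤ 2 * β

/-- The set `𝓑(p) = 𝓑₋(p) ∪ 𝓑₊(p)`. -/
def Bset (p : ℕ) : Finset ℕ := Bminus p ∪ Bplus p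

/-- The height `A(n)` of the `n`-th cyclotomic polynomial. -/
noncomputable def cycHeight (n : ℕ) : ℕ :=
  (Finset.range ((Polynomial.cyclotomic n ℤ).natDegree + 1)).sup
    fun k => ((Polynomial.cyclotomic n ℤ).coeff k).natAbs

/-- The number of primes `q` with `p < q ≤ x` for which some prime `r > q`
has `A(pqr) > (p+1)/2`. -/
noncomputable def beiterCount (p x : ℕ) : ℕ :=
  ({q : ℕ | p < q ∧ q ≤ x ∧ q.Prime ∧ ∃ r : ℕ, r.Prime ∧ q < r ∧
    ((p : ℝ) + 1) / 2 < (cycHeight (p * q * r) : ℝ)}).ncard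

open Polynomial in
lemma cyclotomic_mul_prime_mul_sub_one {p q : ℕ} (hp : p.Prime) (hq : q.Prime) (hpq : p ≠ q) :
    cyclotomic (p * q) ℤ * ((X ^ p - 1) * (X ^ q - 1)) = (X ^ (p * q) - 1) * (X - 1) := by
  have := Fact.mk hp
  have h1 := cyclotomic_prime_mul_X_sub_one ℤ p
  have h2 := cyclotomic_expand_eq_cyclotomic_mul hq
    (fun h => hpq ((Nat.prime_dvd_prime_iff_eq hq hp).1 h).symm) ℤ
  have h3 := congrArg (expand ℤ q) h1
  simp only [map_mul, map_sub, map_pow, expand_X, map_one, ← pow_mul] at h3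
  rw [h2] at h3
  rw [mul_comm p q, ← h3, ← h1, mul_comm q p]
  ring

open Polynomial in
lemma cyclotomic_mul_mul_prime_mul_X_pow_sub_one {p q r : ℕ} (hp : p.Prime) (hq : q.Prime)
    (hr : r.Prime) (hpq : p ≠ q) (hpr : p ≠ r) (hqr : q ≠ r) :
    cyclotomic (p * q * r) ℤ * (1 - X ^ (p * q)) =
      expand ℤ r (cyclotomic (p * q) ℤ) * ((∑ m ∈ Finset.range p, X ^ m) * (1 - X ^ q)) := by
  have hdvd : ¬ r ∣ p * q := by
    rw [hr.dvd_mul, Nat.prime_dvd_prime_iff_eq hr hp, Nat.prime_dvd_prime_iff_eq hr hq]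
    grind
  rw [cyclotomic_expand_eq_cyclotomic_mul hr hdvd]
  have h1 := cyclotomic_mul_prime_mul_sub_one hp hq hpq
  have hX : (X - 1 : ℤ[X]) ≠ 0 := X_sub_C_ne_zero 1
  apply mul_right_cancel₀ hX
  have h2 : (∑ m ∈ Finset.range p, X ^ m) * (X - 1 : ℤ[X]) = X ^ p - 1 := geom_sum_mul X p
  linear_combination cyclotomic (p * q * r) ℤ * h1 -
    cyclotomic (p * q * r) ℤ * cyclotomic (p * q) ℤ * (1 - X ^ q) * h2

open Polynomial in
/-- The explicit form of a binary cyclotomic polynomial. -/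
lemma cyclotomic_mul_prime_eq {p q μ l : ℕ} (hp : p.Prime) (hq : q.Prime) (hpq : p ≠ q)
    (hμ : μ ≤ q) (hl : l ≤ p) (h : μ * p + l * q = p * q + 1) :
    cyclotomic (p * q) ℤ =
      ∑ x ∈ Finset.range μ ×ˢ Finset.range l, X ^ (x.1 * p + x.2 * q) -
      ∑ x ∈ Finset.Ico μ q ×ˢ Finset.Ico l p, X ^ (x.1 * p + x.2 * q - p * q) := by
  have hne : ∀ n : ℕ, 0 < n → (X ^ n - 1 : ℤ[X]) ≠ 0 := fun n hn => X_pow_sub_C_ne_zero hn 1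
  apply mul_right_cancel₀ (mul_ne_zero (hne p hp.pos) (hne q hq.pos))
  apply mul_left_cancel₀ (pow_ne_zero (p * q) (X_ne_zero (R := ℤ)))
  rw [cyclotomic_mul_prime_mul_sub_one hp hq hpq]
  have hN : X ^ (p * q) * ∑ x ∈ Finset.Ico μ q ×ˢ Finset.Ico l p,
      (X ^ (x.1 * p + x.2 * q - p * q) : ℤ[X]) =
      (∑ a ∈ Finset.Ico μ q, (X ^ p) ^ a) * ∑ b ∈ Finset.Ico l p, (X ^ q) ^ b := by
    rw [Finset.sum_mul_sum, ← Finset.sum_product', Finset.mul_sum]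
    refine Finset.sum_congr rfl fun x hx => ?_
    simp only [Finset.mem_product, Finset.mem_Ico] at hx
    have : p * q ≤ x.1 * p + x.2 * q := by
      have := Nat.mul_le_mul_right p hx.1.1
      have := Nat.mul_le_mul_right q hx.2.1
      omega
    rw [← pow_add, ← pow_mul, ← pow_mul, ← pow_add]
    congr 1
    rw [Nat.add_sub_cancel' this]
    ring
  have hP : ∑ x ∈ Finset.range μ ×ˢ Finset.range l, (X ^ (x.1 * p + x.2 * q) : ℤ[X]) =
      (∑ a ∈ Finset.range μ, (X ^ p) ^ a) * ∑ b ∈ Finset.range l, (X ^ q) ^ b := by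
    rw [Finset.sum_mul_sum, ← Finset.sum_product']
    refine Finset.sum_congr rfl fun x hx => ?_
    rw [← pow_mul, ← pow_mul, ← pow_add]
    ring
  have e1 : (∑ a ∈ Finset.range μ, (X ^ p) ^ a) * (X ^ p - 1 : ℤ[X]) = X ^ (μ * p) - 1 := by
    rw [geom_sum_mul, ← pow_mul, mul_comm p]
  have e2 : (∑ a ∈ Finset.range l, (X ^ q) ^ a) * (X ^ q - 1 : ℤ[X]) = X ^ (l * q) - 1 := by
    rw [geom_sum_mul, ← pow_mul, mul_comm q]
  have e3 : (∑ a ∈ Finset.Ico μ q, (X ^ p) ^ a) * (X ^ p - 1 : ℤ[X]) =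
      X ^ (p * q) - X ^ (μ * p) := by
    rw [geom_sum_Ico_mul _ hμ, ← pow_mul, ← pow_mul, mul_comm p μ]
  have e4 : (∑ a ∈ Finset.Ico l p, (X ^ q) ^ a) * (X ^ q - 1 : ℤ[X]) =
      X ^ (p * q) - X ^ (l * q) := by
    rw [geom_sum_Ico_mul _ hl, ← pow_mul, ← pow_mul, mul_comm q l, mul_comm q p]
  have e5 : (X ^ (μ * p) * X ^ (l * q) : ℤ[X]) = X ^ (p * q) * X := by
    rw [← pow_add, h, pow_succ]
  rw [hP]
  generalize ∑ x ∈ Finset.Ico μ q ×ˢ Finset.Ico l p,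
    (X ^ (x.1 * p + x.2 * q - p * q) : ℤ[X]) = D at *
  generalize ∑ a ∈ Finset.range μ, (X ^ p : ℤ[X]) ^ a = s1 at *
  generalize ∑ a ∈ Finset.range l, (X ^ q : ℤ[X]) ^ a = s2 at *
  generalize ∑ a ∈ Finset.Ico μ q, (X ^ p : ℤ[X]) ^ a = s3 at *
  generalize ∑ a ∈ Finset.Ico l p, (X ^ q : ℤ[X]) ^ a = s4 at *
  have : X ^ (p * q) * ((X ^ (p * q) - 1) * (X - 1)) =
    X ^ (p * q) * ((X ^ (μ * p) - 1) * (X ^ (l * q) - 1)) -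
     (X ^ (p * q) - X ^ (μ * p)) * (X ^ (p * q) - X ^ (l * q) : ℤ[X]) := by
    linear_combination (1 - X ^ (p * q)) * e5
  rw [this, ← e1, ← e2, ← e3, ← e4]
  linear_combination (X ^ p - 1) * (X ^ q - 1) * hN

/-- The power series `X ^ e / (1 - X ^ N)`. -/
noncomputable def geomSeries (N e : ℕ) : PowerSeries ℤ :=
  PowerSeries.mk fun n => if e ≤ n ∧ e ≡ n [MOD N] then 1 else 0

lemma geomSeries_mul {N : ℕ} (hN : 0 < N) (e : ℕ) :
    geomSeries N e * (1 - PowerSeries.X ^ N) = PowerSeries.X ^ e := by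
  ext n
  rw [mul_sub, mul_one, map_sub, PowerSeries.coeff_X_pow, PowerSeries.coeff_mul_X_pow']
  simp only [geomSeries, PowerSeries.coeff_mk]
  by_cases hn : N ≤ n
  · obtain ⟨k, rfl⟩ := Nat.exists_eq_add_of_le hn
    have h1 : e ≡ N + k [MOD N] ↔ e ≡ k [MOD N] := by simp [Nat.ModEq]
    simp only [h1, hn, if_true, Nat.add_sub_cancel_left]
    by_cases hk : e ≡ k [MOD N]
    · by_cases h2 : e ≤ k
      · simp [hk, h2, show e ≤ N + k by omega, show N + k ≠ e by omega]
      · by_cases h3 : N + k = e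
        · simp [hk, h2, h3]
        · have : ¬ e ≤ N + k := by
            intro h4
            have h5 := (Nat.modEq_iff_dvd' (by omega : k ≤ e)).1 hk.symm
            have := Nat.le_of_dvd (by omega) h5
            omega
          simp [hk, h2, h3, this]
    · have : N + k ≠ e := by
        rintro rfl
        exact hk (by simp [Nat.ModEq])
      simp [hk, this]
  · simp only [hn, if_false, sub_zero]
    by_cases h3 : n = e
    · simp [h3, Nat.ModEq.refl]
    · have : ¬ (e ≤ n ∧ e ≡ n [MOD N]) := by
        rintro ⟨h4, h5⟩
        have h6 := (Nat.modEq_iff_dvd' h4).1 h5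
        have := Nat.le_of_dvd (by omega) h6
        omega
      simp [h3, this]

/-- The coefficient of `X ^ n` in `Φ_{pq}(X ^ r) X ^ k / (1 - X ^ (p q))`,
where `μ p + l q = p q + 1`. -/
noncomputable def sectionCoeff (p q r μ l n k : ℕ) : ℤ :=
  (∑ x ∈ Finset.range μ ×ˢ Finset.range l,
    if r * (x.1 * p + x.2 * q) + k ≤ n ∧ r * (x.1 * p + x.2 * q) + k ≡ n [MOD p * q]
      then 1 else 0) -
  ∑ x ∈ Finset.Ico μ q ×ˢ Finset.Ico l p,
    if r * (x.1 * p + x.2 * q - p * q) + k ≤ n ∧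
      r * (x.1 * p + x.2 * q - p * q) + k ≡ n [MOD p * q] then 1 else 0

open Polynomial in
lemma coeff_cyclotomic_mul_mul_prime {p q r μ l : ℕ} (hp : p.Prime) (hq : q.Prime)
    (hr : r.Prime) (hpq : p ≠ q) (hpr : p ≠ r) (hqr : q ≠ r)
    (hμ : μ ≤ q) (hl : l ≤ p) (h : μ * p + l * q = p * q + 1) (n : ℕ) :
    (cyclotomic (p * q * r) ℤ).coeff n = ∑ m ∈ Finset.range p,
      (sectionCoeff p q r μ l n m - sectionCoeff p q r μ l n (m + q)) := by
  have hN : 0 < p * q := Nat.mul_pos hp.pos hq.pos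
  have key := cyclotomic_mul_mul_prime_mul_X_pow_sub_one hp hq hr hpq hpr hqr
  rw [cyclotomic_mul_prime_eq hp hq hpq hμ hl h] at key
  simp only [map_sub, map_sum, map_pow, expand_X, ← pow_mul] at key
  let T : ℕ → PowerSeries ℤ := fun k =>
    ∑ x ∈ Finset.range μ ×ˢ Finset.range l, geomSeries (p * q) (r * (x.1 * p + x.2 * q) + k) -
    ∑ x ∈ Finset.Ico μ q ×ˢ Finset.Ico l p,
      geomSeries (p * q) (r * (x.1 * p + x.2 * q - p * q) + k)
  have hT : ∀ k, PowerSeries.coeff n (T k) = sectionCoeff p q r μ l n k := by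
    intro k
    simp [T, geomSeries, sectionCoeff, map_sum]
  have hne : (1 - PowerSeries.X ^ (p * q) : PowerSeries ℤ) ≠ 0 := by
    intro h0
    have := congrArg (PowerSeries.coeff 0) h0
    simp [hp.ne_zero, hq.ne_zero] at this
  have hser : (cyclotomic (p * q * r) ℤ : PowerSeries ℤ) =
      ∑ m ∈ Finset.range p, (T m - T (m + q)) := by
    apply mul_right_cancel₀ hne
    have key' := congrArg (coeToPowerSeries.ringHom (R := ℤ)) key
    simp only [map_mul, map_sub, map_sum, map_pow, map_one,
      coeToPowerSeries.ringHom_apply, coe_X] at key'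
    rw [key', ← mul_assoc, Finset.mul_sum, Finset.sum_mul, Finset.sum_mul]
    refine Finset.sum_congr rfl fun m _ => ?_
    simp only [T, sub_mul, Finset.sum_mul, geomSeries_mul hN, pow_add]
    simp only [← Finset.sum_mul]
    ring
  rw [← Polynomial.coeff_coe, hser, map_sum]
  simp [hT]

lemma add_mul_inj_zmod {p q a b A B : ℕ} (hpq : p.Coprime q) (ha : a < q) (hb : b < p)
    (hA : A < q) (hB : B < p)
    (h : ((a * p + b * q : ℕ) : ZMod (p * q)) = ((A * p + B * q : ℕ) : ZMod (p * q))) :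
    a = A ∧ b = B := by
  rw [ZMod.natCast_eq_natCast_iff] at h
  constructor
  · have h1 : a * p ≡ A * p [MOD q] := by
      have := h.of_mul_left p
      simpa [Nat.ModEq, Nat.add_mul_mod_self_right] using this
    have h2 := Nat.ModEq.cancel_right_of_coprime (by rwa [Nat.coprime_comm] at hpq) h1
    exact Nat.ModEq.eq_of_lt_of_lt h2 ha hA
  · have h1 : b * q ≡ B * q [MOD p] := by
      have := h.of_mul_right q
      simpa [Nat.ModEq, Nat.add_comm (_ * p), Nat.add_mul_mod_self_right] using this
    have h2 := Nat.ModEq.cancel_right_of_coprime hpq h1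
    exact Nat.ModEq.eq_of_lt_of_lt h2 hb hB

/-- The contribution of the lattice point `A p + B q` to the coefficients of `Φ_{pq}` of index at
most `t`, where `μ p + l q = p q + 1`. -/
def truncCoeff (p q μ l t A B : ℕ) : ℤ :=
  (if A < μ ∧ B < l ∧ A * p + B * q ≤ t then 1 else 0) -
    if μ ≤ A ∧ l ≤ B ∧ A * p + B * q - p * q ≤ t then 1 else 0

lemma sectionCoeff_eq_truncCoeff {p q r μ l t s k A B : ℕ} {w c : ZMod (p * q)}
    (hpq : p.Coprime q) (hμ : μ ≤ q) (hl : l ≤ p) (h : μ * p + l * q = p * q + 1)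
    (hrw : (r : ZMod (p * q)) * w = 1) (hA : A < q) (hB : B < p) (hk : k ≤ s) (hs : s < r)
    (hn : ((r * t + s : ℕ) : ZMod (p * q)) = r * c)
    (hpt : ((A * p + B * q : ℕ) : ZMod (p * q)) = c - k * w) :
    sectionCoeff p q r μ l (r * t + s) k = truncCoeff p q μ l t A B := by
  have hle : ∀ e, r * e + k ≤ r * t + s ↔ e ≤ t := by
    intro e
    constructor
    · intro h1
      by_contra! h2
      have : r * (t + 1) ≤ r * e := Nat.mul_le_mul_left r h2
      rw [mul_add] at this
      omega
    · intro h1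
      have := Nat.mul_le_mul_left r h1
      omega
  have hmod : ∀ e, r * e + k ≡ r * t + s [MOD p * q] ↔
      (e : ZMod (p * q)) = ((A * p + B * q : ℕ) : ZMod (p * q)) := by
    intro e
    rw [← ZMod.natCast_eq_natCast_iff, hn, hpt]
    push_cast
    constructor
    · intro h1
      linear_combination w * h1 - (e - c) * hrw
    · intro h1
      linear_combination r * h1 - k * hrw
  simp only [sectionCoeff, truncCoeff, hle, hmod]
  congr 1
  · by_cases hin : A < μ ∧ B < l
    · rw [Finset.sum_eq_single_of_mem (A, B) (by simp [hin])]
      · simp [hin]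
      · rintro ⟨a, b⟩ hx hne
        simp only [Finset.mem_product, Finset.mem_range] at hx
        rw [if_neg]
        rintro ⟨-, h1⟩
        obtain ⟨rfl, rfl⟩ := add_mul_inj_zmod hpq (by omega) (by omega) hA hB h1
        exact hne rfl
    · rw [if_neg (by tauto), Finset.sum_eq_zero]
      rintro ⟨a, b⟩ hx
      simp only [Finset.mem_product, Finset.mem_range] at hx
      rw [if_neg]
      rintro ⟨-, h1⟩
      obtain ⟨rfl, rfl⟩ := add_mul_inj_zmod hpq (by omega) (by omega) hA hB h1
      exact hin hx
  · have hsub : ∀ a b, μ ≤ a → l ≤ b → p * q ≤ a * p + b * q := by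
      intro a b h1 h2
      have := Nat.mul_le_mul_right p h1
      have := Nat.mul_le_mul_right q h2
      omega
    have hcast : ∀ a b, μ ≤ a → l ≤ b → ((a * p + b * q - p * q : ℕ) : ZMod (p * q)) =
        ((a * p + b * q : ℕ) : ZMod (p * q)) := by
      intro a b h1 h2
      rw [Nat.cast_sub (hsub a b h1 h2), ZMod.natCast_self, sub_zero]
    by_cases hin : μ ≤ A ∧ l ≤ B
    · rw [Finset.sum_eq_single_of_mem (A, B) (by simp [hin, hA, hB])]
      · simp only [hcast A B hin.1 hin.2, hin, true_and, and_true]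
      · rintro ⟨a, b⟩ hx hne
        simp only [Finset.mem_product, Finset.mem_Ico] at hx
        rw [if_neg]
        rintro ⟨-, h1⟩
        rw [hcast a b hx.1.1 hx.2.1] at h1
        obtain ⟨rfl, rfl⟩ := add_mul_inj_zmod hpq (by omega) (by omega) hA hB h1
        exact hne rfl
    · rw [if_neg (by tauto), Finset.sum_eq_zero]
      rintro ⟨a, b⟩ hx
      simp only [Finset.mem_product, Finset.mem_Ico] at hx
      rw [if_neg]
      rintro ⟨-, h1⟩
      rw [hcast a b hx.1.1 hx.2.1] at h1
      obtain ⟨rfl, rfl⟩ := add_mul_inj_zmod hpq (by omega) (by omega) hA hB h1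
      exact hin ⟨hx.1.1, hx.2.1⟩

open Polynomial in
lemma exists_prime_coeff_cyclotomic_eq {p q μ l t : ℕ} (hp : p.Prime) (hq : q.Prime) (hpq : p < q)
    (hμ : μ ≤ q) (hl : l ≤ p) (h : μ * p + l * q = p * q + 1) {w c : ZMod (p * q)}
    (hw : IsUnit w) (A B B' : ℕ → ℕ) (hA : ∀ m < p, A m < q) (hB : ∀ m < p, B m < p)
    (hB' : ∀ m < p, B' m < p)
    (hAB : ∀ m < p, ((A m * p + B m * q : ℕ) : ZMod (p * q)) = c - m * w)
    (hAB' : ∀ m < p, ((A m * p + B' m * q : ℕ) : ZMod (p * q)) = c - (m + q : ℕ) * w) :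
    ∃ r : ℕ, r.Prime ∧ q < r ∧ ∃ n, (cyclotomic (p * q * r) ℤ).coeff n =
      ∑ m ∈ Finset.range p, (truncCoeff p q μ l t (A m) (B m) -
        truncCoeff p q μ l t (A m) (B' m)) := by
  have : NeZero (p * q) := ⟨(Nat.mul_pos hp.pos hq.pos).ne'⟩
  obtain ⟨v, rfl⟩ := hw
  obtain ⟨r, hr, hrp, hrw⟩ := Nat.forall_exists_prime_gt_and_eq_mod
    (v⁻¹).isUnit (p + q + p * q)
  refine ⟨r, hrp, by omega, ?_⟩
  let z : ZMod (p * q) := r * c - r * t - p - q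
  let s := p + q + z.val
  have hz : z.val < p * q := ZMod.val_lt z
  have hn : ((r * t + s : ℕ) : ZMod (p * q)) = r * c := by
    simp only [s]
    push_cast
    rw [ZMod.natCast_val, ZMod.cast_id]
    simp only [z]
    ring
  have hrw' : (r : ZMod (p * q)) * v = 1 := by rw [hrw]; simp
  have hcop : p.Coprime q := (Nat.coprime_primes hp hq).2 hpq.ne
  refine ⟨r * t + s, ?_⟩
  rw [coeff_cyclotomic_mul_mul_prime hp hq hrp hpq.ne (by omega) (by omega) hμ hl h]
  refine Finset.sum_congr rfl fun m hm => ?_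
  have hm := Finset.mem_range.1 hm
  rw [sectionCoeff_eq_truncCoeff hcop hμ hl h hrw' (hA m hm) (hB m hm) (by omega) (by omega) hn
      (hAB m hm),
    sectionCoeff_eq_truncCoeff hcop hμ hl h hrw' (hA m hm) (hB' m hm) (by omega) (by omega) hn
      (hAB' m hm)]

lemma exists_step {p q β K : ℕ} (hp : 0 < p) (hK : K + β + 1 = p) (hβ : 2 * β + 3 ≤ p) :
    ∃ u, 0 < u ∧ (K - β) * q < K * (u * p) ∧ K * (u * p) ≤ (K - β) * q + K * p := by
  have hKp : 0 < K * p := Nat.mul_pos (by omega) hp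
  refine ⟨(K - β) * q / (K * p) + 1, Nat.succ_pos _, ?_, ?_⟩
  · have := Nat.lt_div_mul_add (a := (K - β) * q) hKp
    calc _ < _ := this
      _ = _ := by ring
  · have := Nat.div_mul_le_self ((K - β) * q) (K * p)
    calc _ = (K - β) * q / (K * p) * (K * p) + K * p := by ring
      _ ≤ _ := by omega

lemma isUnit_step {p q u : ℕ} (hp : p.Prime) (hq : q.Prime) (hpq : p < q) (hu : 0 < u)
    (huq : u < q) : IsUnit ((u * p - q : ℤ) : ZMod (p * q)) := by
  have hcop : p.Coprime q := (Nat.coprime_primes hp hq).2 hpq.ne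
  rw [ZMod.coe_int_isUnit_iff_isCoprime]
  push_cast
  refine IsCoprime.mul_left ?_ ?_
  · rw [show (u * p - q : ℤ) = -q + p * u by ring, IsCoprime.add_mul_left_right_iff,
      IsCoprime.neg_right_iff]
    exact Nat.isCoprime_iff_coprime.2 hcop
  · rw [show (u * p - q : ℤ) = (u * p : ℕ) + q * (-1) by push_cast; ring,
      IsCoprime.add_mul_left_right_iff]
    refine Nat.isCoprime_iff_coprime.2 (Nat.Coprime.mul_right ?_ hcop.symm)
    exact (Nat.Prime.coprime_iff_not_dvd hq).2 fun h => by
      have := Nat.le_of_dvd hu h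
      omega

lemma sum_ite_le_eq {p K : ℕ} (hK : K < p) (f : ℕ → ℤ) (a : ℤ) (h : ∀ m < p, f m = if m ≤ K then a else 0) :
    ∑ m ∈ Finset.range p, f m = (K + 1) * a := by
  rw [Finset.sum_congr rfl fun m hm => h m (Finset.mem_range.1 hm), ← Finset.sum_filter,
    Finset.sum_const]
  have : (Finset.range p).filter (· ≤ K) = Finset.range (K + 1) := by
    ext m
    simp only [Finset.mem_filter, Finset.mem_range]
    omega
  rw [this, Finset.card_range, nsmul_eq_mul]
  push_cast
  ring

open Polynomial in
lemma exists_coeff_eq_of_plus {p q β l μ K : ℕ} (hp : p.Prime) (hq : q.Prime) (hpq : p * p < q)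
    (hqβ : q ≡ β [MOD p]) (hl : l < p) (h : μ * p + l * q = p * q + 1)
    (hK : K + β + 1 = p) (hβ : 2 * β + 3 ≤ p) (h1 : p ≤ β + l) (h2 : l ≤ 2 * β) :
    ∃ r : ℕ, r.Prime ∧ q < r ∧ ∃ n, (cyclotomic (p * q * r) ℤ).coeff n = K + 1 := by
  obtain ⟨u, hu, hu1, hu2⟩ := exists_step (q := q) hp.pos hK hβ
  have hpp : p ≤ p * p := Nat.le_mul_self p
  have hKp : K * p ≤ p * p := Nat.mul_le_mul_right p (by omega)
  have hKu : K * u < μ := by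
    have e1 : (K - β) * q + q + l * q ≤ p * q := by
      have : (K - β + 1 + l) * q ≤ p * q := Nat.mul_le_mul_right q (by omega)
      linarith
    have : K * u * p < μ * p := by
      rw [mul_assoc]
      omega
    exact lt_of_mul_lt_mul_right this (Nat.zero_le p)
  have hupq : u * p < q := by
    have e1 : μ * p ≤ K * q := by
      have : p * q + q ≤ (K + l) * q := by
        rw [← Nat.succ_mul]
        exact Nat.mul_le_mul_right q (by omega)
      have := hq.pos
      linarith
    have e2 : K * (u * p) < K * q := by
      have := Nat.mul_lt_mul_of_pos_right hKu hp.pos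
      rw [mul_assoc] at this
      omega
    exact lt_of_mul_lt_mul_left e2 (Nat.zero_le K)
  obtain ⟨e, he⟩ := Nat.exists_eq_add_of_lt hupq
  have hKe : K * (e + 1) < β * q := by
    have e1 : K * q = K * (u * p) + K * (e + 1) := by
      rw [← mul_add]; congr 1
    have e2 : K * q = (K - β) * q + β * q := by
      rw [← add_mul]; congr 1; omega
    omega
  have huq : u < q := lt_of_le_of_lt (Nat.le_mul_of_pos_right u hp.pos) hupq
  have hyu : ∀ y, y ≤ β → y * u + μ ≤ q := by
    intro y hy
    have e1 : β * q + q ≤ l * q := by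
      rw [← Nat.succ_mul]
      exact Nat.mul_le_mul_right q (by omega)
    have e2 : y * (u * p) ≤ β * q := Nat.mul_le_mul hy hupq.le
    have : (y * u + μ) * p ≤ q * p := by
      have := hq.pos
      linarith
    exact le_of_mul_le_mul_right this hp.pos
  have hμq : μ ≤ q := by simpa using hyu 0 (Nat.zero_le β)
  have hzero : (p : ZMod (p * q)) * q = 0 := by
    rw [← Nat.cast_mul, ZMod.natCast_self]
  have hqq : (q : ZMod (p * q)) * q = β * q := by
    have := Nat.ModEq.mul_right' q hqβ
    rw [← Nat.cast_mul, ← Nat.cast_mul]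
    exact (ZMod.natCast_eq_natCast_iff _ _ _).2 this
  obtain ⟨r, hr, hqr, n, hn⟩ := exists_prime_coeff_cyclotomic_eq (t := K * q)
    (c := ((K * u * p : ℕ) : ZMod (p * q))) hp hq (hpp.trans_lt hpq)
    hμq hl.le h (isUnit_step hp hq (hpp.trans_lt hpq) hu huq)
    (fun m => if m ≤ K then (K - m) * u else q - (m - K) * u) (fun m => m)
    (fun m => if m ≤ K then m + β else m + β - p)
    (by
      intro m hm
      by_cases hmK : m ≤ K
      · simp only [hmK, if_true]
        have : (K - m) * u ≤ K * u := Nat.mul_le_mul_right u (by omega)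
        omega
      · simp only [hmK, if_false]
        have : 0 < (m - K) * u := Nat.mul_pos (by omega) hu
        have := hq.pos
        omega)
    (fun m hm => hm)
    (by
      intro m hm
      split_ifs <;> omega)
    (by
      intro m hm
      by_cases hmK : m ≤ K
      · simp only [hmK, if_true]
        obtain ⟨x, rfl⟩ := Nat.exists_eq_add_of_le hmK
        rw [Nat.add_sub_cancel_left]
        push_cast
        ring
      · simp only [hmK, if_false]
        obtain ⟨y, rfl⟩ := Nat.exists_eq_add_of_le (not_le.1 hmK).le
        rw [Nat.add_sub_cancel_left]
        have := hyu y (by omega)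
        push_cast [Nat.cast_sub (show y * u ≤ q by omega)]
        linear_combination hzero)
    (by
      intro m hm
      by_cases hmK : m ≤ K
      · simp only [hmK, if_true]
        obtain ⟨x, rfl⟩ := Nat.exists_eq_add_of_le hmK
        rw [Nat.add_sub_cancel_left]
        push_cast
        linear_combination -hqq + u * hzero
      · simp only [hmK, if_false]
        obtain ⟨y, rfl⟩ := Nat.exists_eq_add_of_le (not_le.1 hmK).le
        rw [Nat.add_sub_cancel_left]
        have := hyu y (by omega)
        push_cast [Nat.cast_sub (show y * u ≤ q by omega),
          Nat.cast_sub (show p ≤ K + y + β by omega)]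
        linear_combination -hqq + u * hzero)
  refine ⟨r, hr, hqr, n, ?_⟩
  rw [hn, sum_ite_le_eq (K := K) (a := 1) (by omega), mul_one]
  intro m hm
  by_cases hmK : m ≤ K
  · simp only [hmK, if_true]
    obtain ⟨x, rfl⟩ := Nat.exists_eq_add_of_le hmK
    rw [Nat.add_sub_cancel_left]
    have e1 : x * u ≤ (m + x) * u := Nat.mul_le_mul_right u (by omega)
    have e2 : x * (e + 1) ≤ (m + x) * (e + 1) := Nat.mul_le_mul_right _ (by omega)
    have e3 : (m + x) * q = m * q + x * u * p + x * (e + 1) := by rw [he]; ring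
    have e4 : (m + β) * q = m * q + β * q := add_mul _ _ _
    simp only [truncCoeff]
    rw [if_pos ⟨by omega, by omega, by omega⟩, if_neg (by omega), if_neg (by omega),
      if_neg (by omega)]
    rfl
  · simp only [hmK, if_false]
    obtain ⟨y, rfl⟩ := Nat.exists_eq_add_of_le (not_le.1 hmK).le
    rw [Nat.add_sub_cancel_left]
    have e0 := hyu y (by omega)
    have e1 : (q - y * u) * p = p * q - y * (u * p) := by
      rw [Nat.sub_mul]; congr 1 <;> ring
    have e2 : y * (u * p) ≤ p * q := by
      have := Nat.mul_le_mul_right p (show y * u ≤ q by omega)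
      linarith
    have e3 : (K + y) * q = K * q + y * (u * p) + y * (e + 1) := by
      have : y * q = y * (u * p) + y * (e + 1) := by
        rw [← mul_add]; congr 1
      rw [add_mul, this]; ring
    have e4 : 0 < y * (e + 1) := Nat.mul_pos (by omega) (by omega)
    simp only [truncCoeff]
    rw [if_neg (by omega), if_neg (by omega), if_neg (by omega), if_neg (by omega)]
    rfl

open Polynomial in
lemma exists_coeff_eq_of_minus {p q β l μ K : ℕ} (hp : p.Prime) (hq : q.Prime) (hpq : p * p < q)
    (hqβ : q ≡ β [MOD p]) (h : μ * p + l * q = p * q + 1)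
    (hK : K + β + 1 = p) (hβ : 2 * β + 3 ≤ p) (h1 : p ≤ β + 2 * l + 1) (h2 : l < β) :
    ∃ r : ℕ, r.Prime ∧ q < r ∧ ∃ n, (cyclotomic (p * q * r) ℤ).coeff n = -(K + 1) := by
  obtain ⟨u, hu, hu1, hu2⟩ := exists_step (q := q) hp.pos hK hβ
  have hpp : p ≤ p * p := Nat.le_mul_self p
  have hKp : K * p + p ≤ p * p := by
    rw [← Nat.succ_mul]
    exact Nat.mul_le_mul_right p (by omega)
  have hDl : (K - β) * q + q ≤ l * q := by
    rw [← Nat.succ_mul]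
    exact Nat.mul_le_mul_right q (by omega)
  have hKu : μ + K * u < q := by
    have : (μ + K * u) * p < q * p := by
      rw [add_mul, mul_assoc, mul_comm q p]
      omega
    exact lt_of_mul_lt_mul_right this (Nat.zero_le p)
  have hupq : u * p < q := by
    have e1 : l * q ≤ K * q := Nat.mul_le_mul_right q (by omega)
    have e2 : K * (u * p) < K * q := by omega
    exact lt_of_mul_lt_mul_left e2 (Nat.zero_le K)
  obtain ⟨e, he⟩ := Nat.exists_eq_add_of_lt hupq
  have hmul : ∀ y, y * q = y * (u * p) + y * (e + 1) := by
    intro y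
    rw [← mul_add]; congr 1
  have hKe : K * (e + 1) < β * q := by
    have e1 := hmul K
    have e2 : K * q = (K - β) * q + β * q := by
      rw [← add_mul]; congr 1; omega
    omega
  have huq : u < q := lt_of_le_of_lt (Nat.le_mul_of_pos_right u hp.pos) hupq
  have hyu : ∀ y, y ≤ β → y * u ≤ μ := by
    intro y hy
    have e1 : (β + l) * q ≤ p * q := Nat.mul_le_mul_right q (by omega)
    have e2 : y * (u * p) ≤ β * q := Nat.mul_le_mul hy hupq.le
    have : (y * u) * p ≤ μ * p := by
      rw [add_mul] at e1
      rw [mul_assoc]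
      omega
    exact le_of_mul_le_mul_right this hp.pos
  have hzero : (p : ZMod (p * q)) * q = 0 := by
    rw [← Nat.cast_mul, ZMod.natCast_self]
  have hqq : (q : ZMod (p * q)) * q = β * q := by
    have := Nat.ModEq.mul_right' q hqβ
    rw [← Nat.cast_mul, ← Nat.cast_mul]
    exact (ZMod.natCast_eq_natCast_iff _ _ _).2 this
  obtain ⟨r, hr, hqr, n, hn⟩ := exists_prime_coeff_cyclotomic_eq (t := K * q + 1)
    (c := (((μ + K * u) * p + l * q : ℕ) : ZMod (p * q))) hp hq (hpp.trans_lt hpq)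
    (by omega) (by omega) h (isUnit_step hp hq (hpp.trans_lt hpq) hu huq)
    (fun m => if m ≤ K then μ + (K - m) * u else μ - (m - K) * u)
    (fun m => if m + l < p then l + m else l + m - p)
    (fun m => if m + l + β < p then l + m + β else l + m + β - p)
    (by
      intro m hm
      by_cases hmK : m ≤ K
      · simp only [hmK, if_true]
        have : (K - m) * u ≤ K * u := Nat.mul_le_mul_right u (by omega)
        omega
      · simp only [hmK, if_false]
        omega)
    (by
      intro m hm
      split_ifs <;> omega)
    (by
      intro m hm
      split_ifs <;> omega)
    (by
      intro m hm
      have hB : (((if m + l < p then l + m else l + m - p : ℕ)) : ZMod (p * q)) * q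
          = (l + m) * q := by
        split_ifs
        · push_cast; ring
        · rw [Nat.cast_sub (by omega)]
          push_cast
          linear_combination -hzero
      rw [Nat.cast_add, Nat.cast_mul _ q, hB]
      by_cases hmK : m ≤ K
      · simp only [hmK, if_true]
        obtain ⟨x, rfl⟩ := Nat.exists_eq_add_of_le hmK
        rw [Nat.add_sub_cancel_left]
        push_cast
        ring
      · simp only [hmK, if_false]
        obtain ⟨y, rfl⟩ := Nat.exists_eq_add_of_le (not_le.1 hmK).le
        rw [Nat.add_sub_cancel_left]
        push_cast [Nat.cast_sub (hyu y (by omega))]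
        ring)
    (by
      intro m hm
      have hB : (((if m + l + β < p then l + m + β else l + m + β - p : ℕ)) : ZMod (p * q)) * q
          = (l + m + β) * q := by
        split_ifs
        · push_cast; ring
        · rw [Nat.cast_sub (by omega)]
          push_cast
          linear_combination -hzero
      rw [Nat.cast_add, Nat.cast_mul _ q, hB]
      by_cases hmK : m ≤ K
      · simp only [hmK, if_true]
        obtain ⟨x, rfl⟩ := Nat.exists_eq_add_of_le hmK
        rw [Nat.add_sub_cancel_left]
        push_cast
        linear_combination -hqq + u * hzero
      · simp only [hmK, if_false]
        obtain ⟨y, rfl⟩ := Nat.exists_eq_add_of_le (not_le.1 hmK).le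
        rw [Nat.add_sub_cancel_left]
        push_cast [Nat.cast_sub (hyu y (by omega))]
        linear_combination -hqq + u * hzero)
  refine ⟨r, hr, hqr, n, ?_⟩
  rw [hn, sum_ite_le_eq (K := K) (a := -1) (by omega), mul_neg_one]
  intro m hm
  by_cases hmK : m ≤ K
  · simp only [hmK, if_true]
    obtain ⟨x, rfl⟩ := Nat.exists_eq_add_of_le hmK
    rw [Nat.add_sub_cancel_left, if_pos (by omega)]
    have e1 : x * (e + 1) ≤ (m + x) * (e + 1) := Nat.mul_le_mul_right _ (by omega)
    have e2 := hmul x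
    have e3 : (m + x) * q = m * q + x * q := add_mul _ _ _
    have e4 : (μ + x * u) * p = μ * p + x * (u * p) := by ring
    have e5 : (l + m) * q = l * q + m * q := add_mul _ _ _
    have e6 : (l + m + β) * q = l * q + m * q + β * q := by ring
    have t1 : truncCoeff p q μ l ((m + x) * q + 1) (μ + x * u) (l + m) = -1 := by
      simp only [truncCoeff]
      rw [if_neg (by omega), if_pos ⟨by omega, by omega, by omega⟩]
      rfl
    have t2 : truncCoeff p q μ l ((m + x) * q + 1) (μ + x * u)
        (if m + l + β < p then l + m + β else l + m + β - p) = 0 := by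
      simp only [truncCoeff]
      split_ifs <;> first | rfl | omega
    rw [t1, t2]
    rfl
  · simp only [hmK, if_false]
    obtain ⟨y, rfl⟩ := Nat.exists_eq_add_of_le (not_le.1 hmK).le
    rw [Nat.add_sub_cancel_left]
    have e0 := hyu y (by omega)
    have e1 : (μ - y * u) * p = μ * p - y * (u * p) := by
      rw [Nat.sub_mul, mul_assoc]
    have e2 : y * (u * p) ≤ μ * p := by
      have := Nat.mul_le_mul_right p e0
      linarith
    have e3 : (K + y) * q = K * q + y * q := add_mul _ _ _
    have e4 := hmul y
    have e5 : 0 < y * u := Nat.mul_pos (by omega) hu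
    have e6 : 0 < y * (e + 1) := Nat.mul_pos (by omega) (by omega)
    have t1 : truncCoeff p q μ l (K * q + 1) (μ - y * u)
        (if K + y + l < p then l + (K + y) else l + (K + y) - p) = 0 := by
      simp only [truncCoeff]
      split_ifs with h3 h4 h5 h6
      all_goals try first | rfl | omega
      have e7 : (l + (K + y) - p) * q = l * q + (K + y) * q - p * q := by
        rw [Nat.sub_mul, add_mul]
      have e8 : p * q ≤ l * q + (K + y) * q := by
        rw [← add_mul]
        exact Nat.mul_le_mul_right q (by omega)
      omega
    have t2 : truncCoeff p q μ l (K * q + 1) (μ - y * u)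
        (if K + y + l + β < p then l + (K + y) + β else l + (K + y) + β - p) = 0 := by
      rw [if_neg (by omega)]
      simp only [truncCoeff]
      rw [if_neg (by omega), if_neg (by omega), sub_zero]
    rw [t1, t2, sub_zero]

lemma natAbs_coeff_le_cycHeight (n k : ℕ) :
    ((Polynomial.cyclotomic n ℤ).coeff k).natAbs ≤ cycHeight n := by
  by_cases hk : k ≤ (Polynomial.cyclotomic n ℤ).natDegree
  · exact Finset.le_sup (f := fun k => ((Polynomial.cyclotomic n ℤ).coeff k).natAbs)
      (Finset.mem_range.2 (Nat.lt_succ_of_le hk))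
  · rw [Polynomial.coeff_eq_zero_of_natDegree_lt (not_le.1 hk)]
    simp

lemma exists_cycHeight_gt {p q β : ℕ} (hp : p.Prime) (hq : q.Prime) (hpq : p * p < q)
    (hβ : β ∈ Bset p) (hqβ : q ≡ β [MOD p]) :
    ∃ r : ℕ, r.Prime ∧ q < r ∧ ((p : ℝ) + 1) / 2 < (cycHeight (p * q * r) : ℝ) := by
  have := Fact.mk hp
  have hβ' : 1 ≤ β ∧ 2 * β + 3 ≤ p := by
    simp only [Bset, Bminus, Bplus, Finset.mem_union, Finset.mem_filter, Finset.mem_Icc] at hβ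
    omega
  obtain ⟨K, hK⟩ : ∃ K, K + β + 1 = p := ⟨p - β - 1, by omega⟩
  have hl : modInv p β < p := ZMod.val_lt _
  have hinv : (modInv p β : ZMod p) * β = 1 := by
    rw [modInv, ZMod.natCast_val, ZMod.cast_id]
    refine inv_mul_cancel₀ fun h0 => ?_
    rw [ZMod.natCast_eq_zero_iff] at h0
    have := Nat.le_of_dvd hβ'.1 h0
    omega
  have hqβ' : (q : ZMod p) = β := (ZMod.natCast_eq_natCast_iff _ _ _).2 hqβ
  obtain ⟨μ, hμ⟩ : ∃ μ, μ * p + modInv p β * q = p * q + 1 := by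
    have hle : modInv p β * q ≤ p * q := Nat.mul_le_mul_right q hl.le
    have : p ∣ p * q + 1 - modInv p β * q := by
      rw [← ZMod.natCast_eq_zero_iff, Nat.cast_sub (by omega)]
      push_cast
      rw [hqβ', hinv, ZMod.natCast_self]
      ring
    obtain ⟨μ, hμ⟩ := this
    exact ⟨μ, by rw [mul_comm μ p]; omega⟩
  have key : ∃ r : ℕ, r.Prime ∧ q < r ∧
      ∃ n, ((Polynomial.cyclotomic (p * q * r) ℤ).coeff n).natAbs = K + 1 := by
    simp only [Bset, Bminus, Bplus, Finset.mem_union, Finset.mem_filter] at hβ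
    rcases hβ with hβ | hβ
    · obtain ⟨r, hr, hqr, n, hn⟩ := exists_coeff_eq_of_minus hp hq hpq hqβ hμ hK
        hβ'.2 hβ.2.2.1 hβ.2.2.2
      exact ⟨r, hr, hqr, n, by omega⟩
    · obtain ⟨r, hr, hqr, n, hn⟩ := exists_coeff_eq_of_plus hp hq hpq hqβ hl hμ hK
        hβ'.2 hβ.2.2.1 hβ.2.2.2
      exact ⟨r, hr, hqr, n, by omega⟩
  obtain ⟨r, hr, hqr, n, hn⟩ := key
  refine ⟨r, hr, hqr, ?_⟩
  have h1 := natAbs_coeff_le_cycHeight (p * q * r) n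
  have h2 : p + 1 < 2 * cycHeight (p * q * r) := by omega
  have h3 : (p : ℝ) + 1 < 2 * cycHeight (p * q * r) := by exact_mod_cast h2
  linarith

section WienerIkehara

open MeasureTheory Set Filter Topology

/-- Half of the Fejér kernel, as the cosine transform of the triangle function on `[0, T]`. -/
noncomputable def fejerKernel (T v : ℝ) : ℝ := ∫ t in (0 : ℝ)..T, (1 - t / T) * Real.cos (t * v)

lemma fejerKernel_zero {T : ℝ} (hT : 0 < T) : fejerKernel T 0 = T / 2 := by
  have h : ∀ t ∈ uIcc 0 T, HasDerivAt (fun t : ℝ => t - t ^ 2 / (2 * T)) (1 - t / T) t := by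
    intro t _
    have := (hasDerivAt_id t).sub (((hasDerivAt_id t).pow 2).div_const (2 * T))
    convert! this using 1
    simp
    field_simp
  simp only [fejerKernel, mul_zero, Real.cos_zero, mul_one]
  rw [intervalIntegral.integral_eq_sub_of_hasDerivAt h
    (Continuous.intervalIntegrable (by fun_prop) _ _)]
  field_simp
  ring

lemma fejerKernel_of_ne_zero {T v : ℝ} (hT : 0 < T) (hv : v ≠ 0) :
    fejerKernel T v = (1 - Real.cos (T * v)) / (T * v ^ 2) := by
  have h : ∀ t ∈ uIcc 0 T, HasDerivAt
      (fun t : ℝ => (1 - t / T) * (Real.sin (t * v) / v) - Real.cos (t * v) / (T * v ^ 2))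
      ((1 - t / T) * Real.cos (t * v)) t := by
    intro t _
    have h0 : HasDerivAt (fun t : ℝ => t * v) v t := by simpa using (hasDerivAt_id t).mul_const v
    have h1 : HasDerivAt (fun t : ℝ => 1 - t / T) (-(1 / T)) t := by
      simpa using ((hasDerivAt_id t).div_const T).const_sub 1
    have := (h1.mul (h0.sin.div_const v)).sub (h0.cos.div_const (T * v ^ 2))
    convert! this using 1
    field_simp
    ring
  rw [fejerKernel, intervalIntegral.integral_eq_sub_of_hasDerivAt h
    (Continuous.intervalIntegrable (by fun_prop) _ _)]
  simp
  field_simp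
  ring

lemma fejerKernel_nonneg {T : ℝ} (hT : 0 < T) (v : ℝ) : 0 ≤ fejerKernel T v := by
  rcases eq_or_ne v 0 with rfl | hv
  · rw [fejerKernel_zero hT]; positivity
  · rw [fejerKernel_of_ne_zero hT hv]
    have := Real.cos_le_one (T * v)
    have : 0 ≤ 1 - Real.cos (T * v) := by linarith
    positivity

lemma fejerKernel_le {T : ℝ} (hT : 0 < T) (v : ℝ) :
    fejerKernel T v ≤ (T / 2 + 2 / T) * (1 + v ^ 2)⁻¹ := by
  rw [← div_eq_mul_inv, le_div_iff₀ (by positivity)]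
  rcases eq_or_ne v 0 with rfl | hv
  · rw [fejerKernel_zero hT]
    have : 0 < 2 / T := by positivity
    linarith
  · rw [fejerKernel_of_ne_zero hT hv]
    have h1 := Real.one_sub_sq_div_two_le_cos (x := T * v)
    have h2 := Real.neg_one_le_cos (T * v)
    have hv2 : 0 < v ^ 2 := by positivity
    have e : (1 - Real.cos (T * v)) / (T * v ^ 2) * (1 + v ^ 2)
        = (1 - Real.cos (T * v)) / (T * v ^ 2) + (1 - Real.cos (T * v)) / T := by
      field_simp
    rw [e]
    refine add_le_add ?_ ?_
    · rw [div_le_iff₀ (by positivity)]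
      nlinarith
    · gcongr
      linarith

lemma fejerKernel_le_of_le {T δ v : ℝ} (hT : 0 < T) (hδ : 0 < δ) (hv : δ ≤ |v|) :
    fejerKernel T v ≤ (2 / T * (1 + (δ ^ 2)⁻¹)) * (1 + v ^ 2)⁻¹ := by
  have hv0 : v ≠ 0 := by rintro rfl; simp at hv; linarith
  have hv2 : δ ^ 2 ≤ v ^ 2 := by rw [← sq_abs v]; gcongr
  rw [fejerKernel_of_ne_zero hT hv0, ← div_eq_mul_inv, div_le_div_iff₀ (by positivity) (by positivity)]
  have h2 := Real.neg_one_le_cos (T * v)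
  have h3 : 1 + v ^ 2 ≤ (1 + (δ ^ 2)⁻¹) * v ^ 2 := by
    have : 1 ≤ (δ ^ 2)⁻¹ * v ^ 2 := by
      rw [inv_mul_eq_div, le_div_iff₀ (by positivity)]; linarith
    linarith
  calc (1 - Real.cos (T * v)) * (1 + v ^ 2) ≤ 2 * (1 + v ^ 2) := by gcongr; linarith
    _ ≤ 2 * ((1 + (δ ^ 2)⁻¹) * v ^ 2) := by gcongr
    _ = _ := by field_simp

lemma le_fejerKernel {T v : ℝ} (hT : 0 < T) (hv : 0 < v) (hv1 : v ≤ 1 / T) :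
    2 / Real.pi ^ 2 * T ≤ fejerKernel T v := by
  rw [fejerKernel_of_ne_zero hT hv.ne', le_div_iff₀ (by positivity)]
  have h0 : T * v ≤ 1 := by
    calc T * v ≤ T * (1 / T) := by gcongr
      _ = 1 := by field_simp
  have := Real.cos_le_one_sub_mul_cos_sq (x := T * v) (by
    rw [abs_of_pos (by positivity)]
    linarith [Real.pi_gt_three])
  calc _ = 2 / Real.pi ^ 2 * (T * v) ^ 2 := by ring
    _ ≤ _ := by linarith

lemma continuous_fejerKernel (T : ℝ) : Continuous (fejerKernel T) := by
  unfold fejerKernel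
  exact intervalIntegral.continuous_parametric_intervalIntegral_of_continuous' (by fun_prop) _ _

lemma integrable_inv_one_add_sq_sub (x : ℝ) : Integrable fun y : ℝ => (1 + (x - y) ^ 2)⁻¹ :=
  integrable_inv_one_add_sq.comp_sub_left x

lemma integrable_mul_fejerKernel {T M : ℝ} (hT : 0 < T) {h : ℝ → ℝ} (hm : Measurable h)
    (hM : ∀ y, |h y| ≤ M) (x : ℝ) : Integrable fun y => h y * fejerKernel T (x - y) := by
  refine Integrable.mono' (((integrable_inv_one_add_sq_sub x).const_mul
    (T / 2 + 2 / T)).const_mul M) ?_ (Eventually.of_forall fun y => ?_)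
  · exact (hm.mul ((continuous_fejerKernel T).comp
      (by fun_prop : Continuous fun y : ℝ => x - y)).measurable).aestronglyMeasurable
  · rw [norm_mul, Real.norm_eq_abs, Real.norm_eq_abs, abs_of_nonneg (fejerKernel_nonneg hT _)]
    exact mul_le_mul (hM y) (fejerKernel_le hT _) (fejerKernel_nonneg hT _)
      ((abs_nonneg _).trans (hM y))

lemma exists_le_integral_mul_fejerKernel {δ η M : ℝ} (hδ : 0 < δ) (hη : 0 < η) (hM : 0 < M) :
    ∃ T > 0, ∃ κ > 0, ∀ h : ℝ → ℝ, Measurable h → (∀ y, |h y| ≤ M) → ∀ x, δ < x →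
      (∀ y, |x - y| ≤ δ → η ≤ h y) →
      κ ≤ ∫ y in Ioi 0, h y * fejerKernel T (x - y) := by
  obtain ⟨T, hT1, hT2⟩ : ∃ T : ℝ, 1 / δ < T ∧
      M * (2 * (1 + (δ ^ 2)⁻¹)) * Real.pi / (η / Real.pi ^ 2) < T :=
    ⟨max (1 / δ) (M * (2 * (1 + (δ ^ 2)⁻¹)) * Real.pi / (η / Real.pi ^ 2)) + 1,
      (le_max_left _ _).trans_lt (lt_add_one _), (le_max_right _ _).trans_lt (lt_add_one _)⟩
  have hT : 0 < T := (by positivity : 0 < 1 / δ).trans hT1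
  have hTδ : 1 / T < δ := by rwa [one_div_lt hT hδ]
  rw [div_lt_iff₀ (by positivity)] at hT2
  refine ⟨T, hT, η / Real.pi ^ 2, by positivity, fun h hm hb x hx hη' => ?_⟩
  set b := M * (2 / T * (1 + (δ ^ 2)⁻¹)) with hbdef
  have hb0 : 0 < b := by positivity
  let g : ℝ → ℝ := fun y => (Ico (x - 1 / T) x).indicator (fun _ => η * (2 / Real.pi ^ 2 * T)) y
    - b * (1 + (x - y) ^ 2)⁻¹
  have hind : Integrable ((Ico (x - 1 / T) x).indicator
      (fun _ : ℝ => η * (2 / Real.pi ^ 2 * T))) :=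
    (integrable_indicator_iff measurableSet_Ico).2 (integrableOn_const (by simp))
  have hg : Integrable g := hind.sub ((integrable_inv_one_add_sq_sub x).const_mul b)
  have hle : ∫ y in Ioi 0, g y ≤ ∫ y in Ioi 0, h y * fejerKernel T (x - y) := by
    refine setIntegral_mono hg.integrableOn (integrable_mul_fejerKernel hT hm hb x).integrableOn
      fun y => ?_
    simp only [g]
    have hk := fejerKernel_nonneg hT (x - y)
    have hpos : 0 < b * (1 + (x - y) ^ 2)⁻¹ := by positivity
    by_cases hy : y ∈ Ico (x - 1 / T) x
    · rw [indicator_of_mem hy]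
      have h1 := hη' y (by rw [abs_of_pos (by linarith [hy.2])]; linarith [hy.1])
      have h2 := le_fejerKernel hT (v := x - y) (by linarith [hy.2]) (by linarith [hy.1])
      have : η * (2 / Real.pi ^ 2 * T) ≤ h y * fejerKernel T (x - y) :=
        mul_le_mul h1 h2 (by positivity) (hη.le.trans h1)
      linarith
    · rw [indicator_of_notMem hy]
      by_cases hyδ : |x - y| ≤ δ
      · have := mul_nonneg (hη.le.trans (hη' y hyδ)) hk
        linarith
      · have h1 := fejerKernel_le_of_le hT hδ (not_le.1 hyδ).le
        have h2 : -(h y * fejerKernel T (x - y)) ≤ M * fejerKernel T (x - y) := by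
          rw [← neg_mul]
          gcongr
          exact (neg_le_abs _).trans (hb y)
        have h3 : M * fejerKernel T (x - y) ≤ b * (1 + (x - y) ^ 2)⁻¹ := by
          rw [hbdef, mul_assoc]
          gcongr
        linarith
  refine le_trans ?_ hle
  have e1 : ∫ y in Ioi (0 : ℝ), (Ico (x - 1 / T) x).indicator
      (fun _ => η * (2 / Real.pi ^ 2 * T)) y = 2 * (η / Real.pi ^ 2) := by
    rw [setIntegral_indicator measurableSet_Ico, inter_eq_self_of_subset_right]
    · rw [setIntegral_const, Real.volume_real_Ico_of_le (by linarith [one_div_pos.2 hT])]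
      simp only [smul_eq_mul]
      field_simp
      ring
    · intro y hy
      exact (by linarith : (0 : ℝ) < x - 1 / T).trans_le hy.1
  have e2 : ∫ y in Ioi (0 : ℝ), (1 + (x - y) ^ 2)⁻¹ ≤ Real.pi := by
    calc _ ≤ ∫ y : ℝ, (1 + (x - y) ^ 2)⁻¹ :=
          setIntegral_le_integral (integrable_inv_one_add_sq_sub x)
            (Eventually.of_forall fun y => by positivity)
      _ = _ := by
          rw [integral_sub_left_eq_self (fun y : ℝ => (1 + y ^ 2)⁻¹), integral_univ_inv_one_add_sq]
  have e3 : b * Real.pi ≤ η / Real.pi ^ 2 := by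
    rw [hbdef, show M * (2 / T * (1 + (δ ^ 2)⁻¹)) * Real.pi =
      M * (2 * (1 + (δ ^ 2)⁻¹)) * Real.pi / T by ring, div_le_iff₀ hT]
    linarith
  simp only [g]
  rw [integral_sub hind.integrableOn ((integrable_inv_one_add_sq_sub x).const_mul b).integrableOn,
    e1, integral_const_mul]
  have := mul_le_mul_of_nonneg_left e2 hb0.le
  linarith

lemma re_integral_mul_cexp (T v : ℝ) :
    (∫ t in (0 : ℝ)..T, (1 - t / T : ℂ) * Complex.exp (t * v * Complex.I)).re =
      fejerKernel T v := by
  have hc : Continuous fun t : ℝ => (1 - t / T : ℂ) * Complex.exp (t * v * Complex.I) := by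
    fun_prop
  have := Complex.reCLM.intervalIntegral_comp_comm (hc.intervalIntegrable (μ := volume) 0 T)
  rw [Complex.reCLM_apply] at this
  rw [← this, fejerKernel]
  refine intervalIntegral.integral_congr fun t _ => ?_
  have e : (1 - t / T : ℂ) * Complex.exp (t * v * Complex.I) =
      ((1 - t / T : ℝ) : ℂ) * Complex.exp ((t * v : ℝ) * Complex.I) := by push_cast; rfl
  simp only [Complex.reCLM_apply]
  rw [e, Complex.re_ofReal_mul, Complex.exp_ofReal_mul_I_re]

lemma integral_exp_mul_fejerKernel {h : ℝ → ℝ} {M : ℝ} (hm : Measurable h) (hM : ∀ y, |h y| ≤ M)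
    {T ε : ℝ} (hT : 0 < T) (hε : 0 < ε) (x : ℝ) :
    ∫ y in Ioi 0, Real.exp (-ε * y) * (h y * fejerKernel T (x - y)) =
      (∫ t in (0 : ℝ)..T, (1 - t / T : ℂ) * Complex.exp (t * x * Complex.I) *
        ∫ y in Ioi (0 : ℝ), (h y : ℂ) * Complex.exp (-(ε + t * Complex.I) * y)).re := by
  let V : ℝ → ℂ := fun y => ((Real.exp (-ε * y) * h y : ℝ) : ℂ)
  let U : ℝ → ℝ → ℂ := fun t y =>
    ((1 - t / T : ℂ) * Complex.exp (t * (x - y : ℝ) * Complex.I))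
  have hV : IntegrableOn V (Ioi 0) := by
    refine Integrable.ofReal ?_
    have : IntegrableOn (fun y => Real.exp (-ε * y)) (Ioi 0) := exp_neg_integrableOn_Ioi 0 hε
    exact Integrable.mul_bdd (c := M) this hm.aestronglyMeasurable (Eventually.of_forall hM)
  have hfub : Integrable (Function.uncurry fun t y : ℝ => V y * U t y)
      ((volume.restrict (Ioc 0 T)).prod (volume.restrict (Ioi 0))) := by
    have h1 : Integrable (fun t : ℝ => (1 - t / T : ℂ)) (volume.restrict (Ioc 0 T)) :=
      ((by fun_prop : Continuous fun t : ℝ => (1 - t / T : ℂ)).intervalIntegrable (μ := volume)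
        0 T).1
    have h2 := (h1.mul_prod hV).bdd_mul (c := 1)
      (f := fun z : ℝ × ℝ => Complex.exp (z.1 * (x - z.2 : ℝ) * Complex.I))
      (by fun_prop : Continuous _).aestronglyMeasurable
      (Eventually.of_forall fun z => by
        rw [← Complex.ofReal_mul, Complex.norm_exp_ofReal_mul_I])
    refine h2.congr (Eventually.of_forall fun z => ?_)
    simp only [Function.uncurry, U]
    ring
  have e1 : ∀ t : ℝ, (1 - t / T : ℂ) * Complex.exp (t * x * Complex.I) *
        (∫ y in Ioi (0 : ℝ), (h y : ℂ) * Complex.exp (-(ε + t * Complex.I) * y)) =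
      ∫ y in Ioi (0 : ℝ), V y * U t y := by
    intro t
    rw [← integral_const_mul]
    congr 1
    ext y
    simp only [V, U]
    push_cast
    have : Complex.exp (t * x * Complex.I) * Complex.exp (-(ε + t * Complex.I) * y) =
        Complex.exp (-ε * y) * Complex.exp (t * (x - y) * Complex.I) := by
      rw [← Complex.exp_add, ← Complex.exp_add]
      congr 1
      ring
    linear_combination (1 - t / T : ℂ) * h y * this
  simp_rw [e1]
  rw [intervalIntegral.integral_of_le hT.le, integral_integral_swap hfub]
  have h_int := hfub.integral_prod_right
  simp only [Function.uncurry] at h_int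
  have := integral_re h_int
  simp only [RCLike.re_to_complex] at this
  rw [← this]
  refine integral_congr_ae (Eventually.of_forall fun y => ?_)
  simp only [V, U]
  rw [integral_const_mul, Complex.re_ofReal_mul, ← intervalIntegral.integral_of_le hT.le,
    re_integral_mul_cexp]
  ring

lemma integral_mul_fejerKernel_eq {h : ℝ → ℝ} {M : ℝ} (hm : Measurable h) (hM : ∀ y, |h y| ≤ M)
    {G : ℝ → ℝ → ℂ} (hG : Continuous (Function.uncurry G))
    (hh : ∀ ε : ℝ, 0 < ε → ∀ t : ℝ,
      ∫ y in Ioi (0 : ℝ), (h y : ℂ) * Complex.exp (-(ε + t * Complex.I) * y) = G ε t)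
    {T : ℝ} (hT : 0 < T) (x : ℝ) :
    ∫ y in Ioi 0, h y * fejerKernel T (x - y) =
      (∫ t in (0 : ℝ)..T, (1 - t / T : ℂ) * Complex.exp (t * x * Complex.I) * G 0 t).re := by
  have h1 : Tendsto (fun ε : ℝ => ∫ y in Ioi 0,
      Real.exp (-ε * y) * (h y * fejerKernel T (x - y))) (𝓝[>] 0)
      (𝓝 (∫ y in Ioi 0, h y * fejerKernel T (x - y))) := by
    have hi := (integrable_mul_fejerKernel hT hm hM x).integrableOn (s := Ioi 0)
    refine tendsto_integral_filter_of_dominated_convergence _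
      (Eventually.of_forall fun ε => ?_) ?_ hi.norm ?_
    · exact (by fun_prop : Continuous fun y : ℝ => Real.exp (-ε * y)).aestronglyMeasurable.mul
        hi.aestronglyMeasurable
    · filter_upwards [self_mem_nhdsWithin] with ε hε
      filter_upwards [ae_restrict_mem measurableSet_Ioi] with y hy
      rw [norm_mul, Real.norm_eq_abs, Real.abs_exp]
      refine mul_le_of_le_one_left (norm_nonneg _) (Real.exp_le_one_iff.2 ?_)
      have := mul_pos (mem_Ioi.1 hε) (mem_Ioi.1 hy)
      linarith
    · refine Eventually.of_forall fun y => ?_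
      have : Continuous fun ε : ℝ => Real.exp (-ε * y) * (h y * fejerKernel T (x - y)) := by
        fun_prop
      have := this.tendsto 0
      simp only [neg_zero, zero_mul, Real.exp_zero, one_mul] at this
      exact this.mono_left nhdsWithin_le_nhds
  have h2 : Tendsto (fun ε : ℝ =>
      (∫ t in (0 : ℝ)..T, (1 - t / T : ℂ) * Complex.exp (t * x * Complex.I) * G ε t).re) (𝓝[>] 0)
      (𝓝 (∫ t in (0 : ℝ)..T,
        (1 - t / T : ℂ) * Complex.exp (t * x * Complex.I) * G 0 t).re) := by
    have : Continuous fun ε : ℝ =>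
        (∫ t in (0 : ℝ)..T, (1 - t / T : ℂ) * Complex.exp (t * x * Complex.I) * G ε t) := by
      refine intervalIntegral.continuous_parametric_intervalIntegral_of_continuous' ?_ _ _
      refine Continuous.mul (by fun_prop) hG
    exact ((Complex.continuous_re.comp this).tendsto 0).mono_left nhdsWithin_le_nhds
  refine tendsto_nhds_unique h1 (h2.congr' ?_)
  filter_upwards [self_mem_nhdsWithin] with ε hε
  rw [integral_exp_mul_fejerKernel hm hM hT hε]
  simp_rw [hh ε hε]

lemma tendsto_integral_mul_fejerKernel {h : ℝ → ℝ} {M : ℝ} (hm : Measurable h)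
    (hM : ∀ y, |h y| ≤ M) {G : ℝ → ℝ → ℂ} (hG : Continuous (Function.uncurry G))
    (hh : ∀ ε : ℝ, 0 < ε → ∀ t : ℝ,
      ∫ y in Ioi (0 : ℝ), (h y : ℂ) * Complex.exp (-(ε + t * Complex.I) * y) = G ε t)
    {T : ℝ} (hT : 0 < T) :
    Tendsto (fun x => ∫ y in Ioi 0, h y * fejerKernel T (x - y)) atTop (𝓝 0) := by
  simp_rw [integral_mul_fejerKernel_eq hm hM hG hh hT]
  let f : ℝ → ℂ := (Ioc 0 T).indicator fun t => (1 - t / T : ℂ) * G 0 t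
  have h1 := (Real.tendsto_integral_exp_smul_cocompact f).mono_left atBot_le_cocompact
  have h2 : Tendsto (fun x : ℝ => x * (-(2 * Real.pi)⁻¹)) atTop atBot :=
    tendsto_id.atTop_mul_const_of_neg (by simp; positivity)
  have h3 := (Complex.continuous_re.tendsto _).comp (h1.comp h2)
  simp only [Complex.zero_re] at h3
  refine h3.congr fun x => ?_
  simp only [Function.comp]
  congr 1
  rw [intervalIntegral.integral_of_le hT.le, ← integral_indicator measurableSet_Ioc]
  congr 1
  ext t
  simp only [f]
  by_cases ht : t ∈ Ioc 0 T
  · rw [indicator_of_mem ht, indicator_of_mem ht, Circle.smul_def, Real.fourierChar_apply, smul_eq_mul,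
      show (2 * Real.pi * -(t * (x * -(2 * Real.pi)⁻¹)) : ℝ) = t * x by field_simp]
    push_cast
    ring
  · rw [indicator_of_notMem ht, indicator_of_notMem ht, smul_zero]

/-- The **Wiener–Ikehara theorem** in additive form. -/
lemma tendsto_of_laplace_continuous {B : ℝ → ℝ} {C c : ℝ} (hB0 : ∀ y, 0 ≤ B y)
    (hBC : ∀ y, B y ≤ C) (hmono : Monotone fun y => Real.exp y * B y)
    {G : ℝ → ℝ → ℂ} (hG : Continuous (Function.uncurry G))
    (hh : ∀ ε : ℝ, 0 < ε → ∀ t : ℝ,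
      ∫ y in Ioi (0 : ℝ), ((B y - c : ℝ) : ℂ) * Complex.exp (-(ε + t * Complex.I) * y) = G ε t) :
    Tendsto B atTop (𝓝 c) := by
  have hBm : Measurable B := by
    have : B = fun y => Real.exp (-y) * (Real.exp y * B y) := by
      ext y
      rw [← mul_assoc, ← Real.exp_add]
      simp
    rw [this]
    exact (by fun_prop : Measurable fun y : ℝ => Real.exp (-y)).mul hmono.measurable
  have hm : Measurable fun y => B y - c := hBm.sub_const c
  set M := C + |c| + 1 with hMdef
  have hC : 0 ≤ C := (hB0 0).trans (hBC 0)
  have hM : ∀ y, |B y - c| ≤ M := by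
    intro y
    have h1 := abs_sub (B y) c
    rw [abs_of_nonneg (hB0 y)] at h1
    linarith [hBC y]
  have hM0 : 0 < M := by positivity
  have hstep : ∀ y z, y ≤ z → B y ≤ Real.exp (z - y) * B z := by
    intro y z hyz
    have := hmono hyz
    simp only at this
    rw [Real.exp_sub, div_mul_eq_mul_div, le_div_iff₀ (Real.exp_pos y)]
    linarith
  rw [tendsto_order]
  constructor
  · intro a ha
    obtain ⟨δ, hδ, hδa⟩ : ∃ δ > 0, ∀ b, 0 ≤ b → b ≤ a → Real.exp (2 * δ) * b ≤ (a + c) / 2 := by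
      rcases lt_or_ge a 0 with ha0 | ha0
      · exact ⟨1, one_pos, fun b hb hb' => by linarith⟩
      have hcont : Tendsto (fun δ : ℝ => Real.exp (2 * δ) * a) (𝓝[>] 0) (𝓝 a) := by
        have : Continuous fun δ : ℝ => Real.exp (2 * δ) * a := by fun_prop
        simpa using (this.tendsto 0).mono_left (nhdsWithin_le_nhds (s := Ioi 0))
      have := (hcont.eventually (gt_mem_nhds (show a < (a + c) / 2 by linarith))).and
        self_mem_nhdsWithin
      obtain ⟨δ, h1, h2⟩ := this.exists
      exact ⟨δ, h2, fun b hb hb' => (by gcongr : _ ≤ Real.exp (2 * δ) * a).trans h1.le⟩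
    obtain ⟨T, hT, κ, hκ, key⟩ := exists_le_integral_mul_fejerKernel hδ
      (show 0 < (c - a) / 2 by linarith) hM0
    have hlim := tendsto_integral_mul_fejerKernel hm hM hG hh hT
    have hsh : Tendsto (fun x : ℝ => x - δ) atTop atTop := tendsto_atTop_add_const_right _ _ tendsto_id
    filter_upwards [(hlim.comp hsh).eventually (lt_mem_nhds (show -κ < 0 by linarith)),
      eventually_gt_atTop (2 * δ)] with x hx hxδ
    by_contra! hBx
    have := key (fun y => -(B y - c)) hm.neg (fun y => by rw [abs_neg]; exact hM y) (x - δ)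
      (by linarith) (fun y hy => ?_)
    · simp only [neg_mul, integral_neg] at this
      simp only [Function.comp] at hx
      linarith
    · rw [abs_le] at hy
      have h1 := hstep y x (by linarith)
      have h2 := hδa (B x) (hB0 x) hBx
      have h3 : Real.exp (x - y) * B x ≤ Real.exp (2 * δ) * B x :=
        mul_le_mul_of_nonneg_right (Real.exp_le_exp.2 (by linarith)) (hB0 x)
      linarith
  · intro a ha
    obtain ⟨δ, hδ, hδa⟩ : ∃ δ > 0, ∀ b, 0 ≤ b → a ≤ b → (a + c) / 2 ≤ Real.exp (-(2 * δ)) * b := by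
      have hcont : Tendsto (fun δ : ℝ => Real.exp (-(2 * δ)) * a) (𝓝[>] 0) (𝓝 a) := by
        have : Continuous fun δ : ℝ => Real.exp (-(2 * δ)) * a := by fun_prop
        simpa using (this.tendsto 0).mono_left (nhdsWithin_le_nhds (s := Ioi 0))
      have := (hcont.eventually (lt_mem_nhds (show (a + c) / 2 < a by linarith))).and
        self_mem_nhdsWithin
      obtain ⟨δ, h1, h2⟩ := this.exists
      exact ⟨δ, h2, fun b hb hb' => h1.le.trans (by gcongr)⟩
    obtain ⟨T, hT, κ, hκ, key⟩ := exists_le_integral_mul_fejerKernel hδ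
      (show 0 < (a - c) / 2 by linarith) hM0
    have hlim := tendsto_integral_mul_fejerKernel hm hM hG hh hT
    have hsh : Tendsto (fun x : ℝ => x + δ) atTop atTop := tendsto_atTop_add_const_right _ _ tendsto_id
    filter_upwards [(hlim.comp hsh).eventually (gt_mem_nhds hκ),
      eventually_gt_atTop (2 * δ)] with x hx hxδ
    by_contra! hBx
    have := key (fun y => B y - c) hm hM (x + δ) (by linarith) (fun y hy => ?_)
    · simp only [Function.comp] at hx
      linarith
    · rw [abs_le] at hy
      have h1 := hstep x y (by linarith)
      have h2 := hδa (B x) (hB0 x) hBx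
      have h3 : Real.exp (-(2 * δ)) * B x ≤ Real.exp (-(y - x)) * B x :=
        mul_le_mul_of_nonneg_right (Real.exp_le_exp.2 (by linarith)) (hB0 x)
      have h4 : Real.exp (-(y - x)) * B x ≤ B y := by
        rw [Real.exp_neg, inv_mul_le_iff₀ (Real.exp_pos _)]
        exact h1
      linarith

lemma integral_Ioi_one_mul_cpow (S : ℝ → ℂ) (z : ℂ) :
    ∫ t in Ioi (1 : ℝ), S t * (t : ℂ) ^ (-(1 + z + 1)) =
      ∫ y in Ioi (0 : ℝ), (Real.exp (-y) * S (Real.exp y)) * Complex.exp (-z * y) := by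
  have himg : Real.exp '' Ioi 0 = Ioi 1 := by
    ext x
    constructor
    · rintro ⟨y, hy, rfl⟩
      exact Real.one_lt_exp_iff.2 hy
    · intro hx
      exact ⟨Real.log x, Real.log_pos hx, Real.exp_log (one_pos.trans hx)⟩
  rw [← himg, integral_image_eq_integral_abs_deriv_smul measurableSet_Ioi
    (fun x _ => (Real.hasDerivAt_exp x).hasDerivWithinAt) Real.exp_injective.injOn]
  refine integral_congr_ae (Eventually.of_forall fun y => ?_)
  simp only [Real.abs_exp, Complex.real_smul]
  rw [Complex.cpow_def_of_ne_zero (by exact_mod_cast (Real.exp_pos y).ne'),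
    ← Complex.ofReal_log (Real.exp_pos y).le, Real.log_exp]
  push_cast
  have : Complex.exp y * Complex.exp (y * -(1 + z + 1)) =
      Complex.exp (-y) * Complex.exp (-z * y) := by
    rw [← Complex.exp_add, ← Complex.exp_add]
    congr 1
    ring
  linear_combination S (Real.exp y) * this

/-- The **Wiener–Ikehara theorem** for Dirichlet series with nonnegative coefficients. -/
lemma tendsto_sum_div_of_continuousOn_LSeries_sub {f : ℕ → ℝ} (hf : ∀ n, 0 ≤ f n) {C c : ℝ}
    (hC : ∀ n : ℕ, ∑ k ∈ Finset.Icc 1 n, f k ≤ C * n) {G : ℂ → ℂ}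
    (hG : ContinuousOn G {s | 1 ≤ s.re})
    (hGf : EqOn G (fun s => LSeries (fun n => f n) s - c / (s - 1)) {s | 1 < s.re}) :
    Tendsto (fun n : ℕ => (∑ k ∈ Finset.Icc 1 n, f k) / n) atTop (𝓝 c) := by
  have hC0 : 0 ≤ C := by
    have := hC 1
    simp only [Finset.Icc_self, Finset.sum_singleton, Nat.cast_one, mul_one] at this
    exact (hf 1).trans this
  let S : ℝ → ℝ := fun t => ∑ k ∈ Finset.Icc 1 ⌊t⌋₊, f k
  have hSmono : Monotone S := fun a b hab =>
    Finset.sum_le_sum_of_subset_of_nonneg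
      (Finset.Icc_subset_Icc_right (Nat.floor_mono hab)) fun k _ _ => hf k
  let B : ℝ → ℝ := fun y => Real.exp (-y) * S (Real.exp y)
  have hB : ∀ y, Real.exp y * B y = S (Real.exp y) := fun y => by
    simp only [B]
    rw [← mul_assoc, ← Real.exp_add]
    simp
  have hmono : Monotone fun y => Real.exp y * B y := by
    simp_rw [hB]
    exact hSmono.comp Real.exp_monotone
  have hB0 : ∀ y, 0 ≤ B y := fun y =>
    mul_nonneg (Real.exp_pos _).le (Finset.sum_nonneg fun k _ => hf k)
  have hBC : ∀ y, B y ≤ C := by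
    intro y
    have h1 : S (Real.exp y) ≤ C * Real.exp y :=
      (hC _).trans (mul_le_mul_of_nonneg_left (Nat.floor_le (Real.exp_pos y).le) hC0)
    simp only [B]
    rw [Real.exp_neg, inv_mul_le_iff₀ (Real.exp_pos y)]
    linarith
  have hBm : Measurable B :=
    (by fun_prop : Measurable fun y : ℝ => Real.exp (-y)).mul
      (hSmono.comp Real.exp_monotone).measurable
  let s : ℝ → ℝ → ℂ := fun ε t => 1 + (max ε 0 : ℝ) + t * Complex.I
  have hs : Continuous (Function.uncurry s) := by
    simp only [s, Function.uncurry_def]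
    fun_prop
  have hsre : ∀ ε t, (s ε t).re = 1 + max ε 0 := by simp [s]
  have hG' : Continuous (Function.uncurry fun ε t => (G (s ε t) - c) / s ε t) := by
    have h1 : Continuous fun x : ℝ × ℝ => G (s x.1 x.2) := by
      refine hG.comp_continuous hs fun x => ?_
      simp [hsre]
    refine (h1.sub continuous_const).div hs fun x hx => ?_
    have := hsre x.1 x.2
    have h0 : s x.1 x.2 = 0 := hx
    rw [h0, Complex.zero_re] at this
    have := le_max_right x.1 0
    linarith
  have hlim : Tendsto B atTop (𝓝 c) := by
    refine tendsto_of_laplace_continuous hB0 hBC hmono hG' fun ε hε t => ?_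
    set z : ℂ := ε + t * Complex.I with hz
    have hzre : z.re = ε := by simp [hz]
    have hsz : s ε t = 1 + z := by
      simp only [s, hz, max_eq_left hε.le]
      ring
    have hexp : IntegrableOn (fun y : ℝ => Complex.exp (-z * y)) (Ioi 0) :=
      integrableOn_exp_mul_complex_Ioi (by simpa [hzre] using hε) 0
    have hBexp : IntegrableOn (fun y : ℝ => (B y : ℂ) * Complex.exp (-z * y)) (Ioi 0) := by
      refine Integrable.bdd_mul (c := C) hexp hBm.complex_ofReal.aestronglyMeasurable
        (Eventually.of_forall fun y => ?_)
      rw [Complex.norm_real, Real.norm_eq_abs, abs_of_nonneg (hB0 y)]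
      exact hBC y
    have hL : LSeries (fun n => f n) (1 + z) =
        (1 + z) * ∫ y in Ioi (0 : ℝ), (B y : ℂ) * Complex.exp (-z * y) := by
      rw [LSeries_eq_mul_integral_of_nonneg f zero_le_one (by simp [hzre, hε]) _ hf]
      · have := integral_Ioi_one_mul_cpow (fun t => (S t : ℂ)) z
        simp only [S, Complex.ofReal_sum] at this
        rw [this]
        simp [B, S]
      · refine Asymptotics.IsBigO.of_bound C (Eventually.of_forall fun n => ?_)
        rw [Real.rpow_one, Real.norm_eq_abs, Real.norm_eq_abs, Nat.abs_cast,
          abs_of_nonneg (Finset.sum_nonneg fun k _ => hf k)]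
        exact hC n
    have hc : ∫ y in Ioi (0 : ℝ), (c : ℂ) * Complex.exp (-z * y) = c / z := by
      rw [integral_const_mul, integral_exp_mul_complex_Ioi (by simpa [hzre] using hε)]
      simp [div_eq_mul_inv]
    have hz0 : z ≠ 0 := by
      intro h
      rw [h, Complex.zero_re] at hzre
      linarith
    have hz1 : 1 + z ≠ 0 := by
      intro h
      have := congrArg Complex.re h
      simp [hzre] at this
      linarith
    simp only [Complex.ofReal_sub, sub_mul]
    rw [integral_sub hBexp (hexp.const_mul _), hc, hsz,
      hGf (show 1 < (1 + z).re by simp [hzre, hε])]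
    simp only [hL, add_sub_cancel_left]
    field_simp
    ring
  have hlog : Tendsto (fun n : ℕ => Real.log n) atTop atTop :=
    Real.tendsto_log_atTop.comp tendsto_natCast_atTop_atTop
  refine (hlim.comp hlog).congr' ?_
  filter_upwards [eventually_gt_atTop 0] with n hn
  have hn' : (0 : ℝ) < n := by exact_mod_cast hn
  simp only [Function.comp, B, S]
  rw [Real.exp_neg, Real.exp_log hn', Nat.floor_natCast, inv_mul_eq_div]

end WienerIkehara

section PrimeNumberTheorem

open Filter Topology Chebyshev ArithmeticFunction

lemma psi_natCast_eq_sum_Icc (n : ℕ) : ψ n = ∑ k ∈ Finset.Icc 1 n, vonMangoldt k := by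
  simp [psi, ← Finset.Icc_add_one_left_eq_Ioc]

/-- The **prime number theorem in arithmetic progressions** for the von Mangoldt function. -/
lemma tendsto_sum_residueClass_div {q : ℕ} [NeZero q] {a : ZMod q} (ha : IsUnit a) :
    Tendsto (fun n : ℕ => (∑ k ∈ Finset.Icc 1 n, vonMangoldt.residueClass a k) / n) atTop
      (𝓝 (q.totient : ℝ)⁻¹) := by
  refine tendsto_sum_div_of_continuousOn_LSeries_sub (vonMangoldt.residueClass_nonneg a)
    (C := Real.log 4 + 4) (fun n => ?_) (vonMangoldt.continuousOn_LFunctionResidueClassAux a) ?_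
  · refine (Finset.sum_le_sum fun k _ => vonMangoldt.residueClass_le a k).trans ?_
    rw [← psi_natCast_eq_sum_Icc]
    exact psi_le_const_mul_self n.cast_nonneg
  · intro s hs
    rw [vonMangoldt.eqOn_LFunctionResidueClassAux ha hs]
    push_cast
    rfl

lemma tendsto_psi_sub_theta_div : Tendsto (fun n : ℕ => (ψ n - θ n) / n) atTop (𝓝 0) := by
  have h1 : (ψ - θ) =o[atTop] fun x : ℝ => x := by
    refine isBigO_psi_sub_theta_sqrt.trans_isLittleO ?_
    refine Asymptotics.isLittleO_of_tendsto' ((eventually_ne_atTop 0).mono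
      fun x hx h => absurd h hx) ?_
    simp only [Real.sqrt_div_self]
    exact Real.tendsto_sqrt_atTop.inv_tendsto_atTop
  exact h1.tendsto_div_nhds_zero.comp tendsto_natCast_atTop_atTop

/-- The **prime number theorem** for the Chebyshev function `ψ`. -/
lemma tendsto_psi_div : Tendsto (fun n : ℕ => ψ n / n) atTop (𝓝 1) := by
  have := tendsto_sum_residueClass_div (q := 1) (a := 1) isUnit_one
  simp only [Nat.totient_one, Nat.cast_one, inv_one] at this
  refine this.congr fun n => ?_
  rw [psi_natCast_eq_sum_Icc]
  congr 1
  refine Finset.sum_congr rfl fun k _ => Set.indicator_of_mem ?_ _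
  exact Subsingleton.elim _ _

/-- The **prime number theorem**. -/
lemma tendsto_primeCounting_mul_log_div :
    Tendsto (fun n : ℕ => (Nat.primeCounting n : ℝ) * Real.log n / n) atTop (𝓝 1) := by
  have h1 : Tendsto (fun n : ℕ => θ n / n) atTop (𝓝 1) := by
    have := tendsto_psi_div.sub tendsto_psi_sub_theta_div
    rw [sub_zero] at this
    exact this.congr fun n => by ring
  have h2 : Tendsto (fun n : ℕ => ((Nat.primeCounting n : ℝ) - θ n / Real.log n) *
      (Real.log n / n)) atTop (𝓝 0) := by
    have h3 := (primeCounting_sub_theta_div_log_isBigO.mul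
      (Asymptotics.isBigO_refl (fun x : ℝ => Real.log x / x) atTop))
    have h4 : (fun x : ℝ => x / Real.log x ^ 2 * (Real.log x / x)) =ᶠ[atTop]
        fun x => (Real.log x)⁻¹ := by
      filter_upwards [eventually_gt_atTop 1] with x hx
      have := Real.log_pos hx
      field_simp
    have h5 := (h3.congr' EventuallyEq.rfl h4).trans_tendsto
      Real.tendsto_log_atTop.inv_tendsto_atTop
    have := h5.comp tendsto_natCast_atTop_atTop
    simpa [Function.comp_def] using this
  have h3 := h1.add h2
  rw [add_zero] at h3
  refine h3.congr' ?_
  filter_upwards [eventually_gt_atTop 1] with n hn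
  have : 0 < Real.log n := Real.log_pos (by exact_mod_cast hn)
  field_simp
  ring

lemma sum_residueClass_le {q : ℕ} (a : ZMod q) (m n : ℕ) :
    ∑ k ∈ Finset.Icc 1 n, vonMangoldt.residueClass a k ≤
      ((Finset.Icc 1 n).filter fun k : ℕ => k.Prime ∧ m < k ∧ (k : ZMod q) = a).card * Real.log n +
        (ψ n - θ n) + ψ m := by
  have h1 : ψ n - θ n = ∑ k ∈ Finset.Icc 1 n, if ¬ k.Prime then vonMangoldt k else 0 := by
    rw [psi_sub_theta_eq_sum_not_prime, Finset.sum_filter, Nat.floor_natCast,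
      ← Finset.Icc_add_one_left_eq_Ioc, zero_add]
  have h2 : (∑ k ∈ Finset.Icc 1 n, if k ≤ m then vonMangoldt k else 0) ≤ ψ m := by
    rw [psi_natCast_eq_sum_Icc, ← Finset.sum_filter]
    refine Finset.sum_le_sum_of_subset_of_nonneg (fun k hk => ?_)
      fun k _ _ => vonMangoldt_nonneg
    simp only [Finset.mem_filter, Finset.mem_Icc] at hk ⊢
    omega
  have h3 : ((Finset.Icc 1 n).filter fun k : ℕ => k.Prime ∧ m < k ∧ (k : ZMod q) = a).card *
      Real.log n = ∑ k ∈ Finset.Icc 1 n,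
        if k.Prime ∧ m < k ∧ (k : ZMod q) = a then Real.log n else 0 := by
    rw [← Finset.sum_filter, Finset.sum_const, nsmul_eq_mul]
  refine le_trans ?_ (add_le_add_right h2 _)
  rw [h1, h3, ← Finset.sum_add_distrib, ← Finset.sum_add_distrib]
  refine Finset.sum_le_sum fun k hk => ?_
  have hk := Finset.mem_Icc.1 hk
  have hΛ : 0 ≤ vonMangoldt k := vonMangoldt_nonneg
  have hlog : vonMangoldt k ≤ Real.log n := vonMangoldt_le_log.trans
    (Real.log_le_log (by exact_mod_cast hk.1) (by exact_mod_cast hk.2))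
  by_cases ha : (k : ZMod q) = a
  · rw [vonMangoldt.residueClass, Set.indicator_of_mem (by exact ha)]
    simp only [ha, and_true]
    by_cases hk1 : k.Prime <;> by_cases hk2 : k ≤ m <;>
      simp only [hk1, hk2, not_lt.2, lt_of_not_ge, not_true, not_false_eq_true, true_and,
        false_and, if_true, if_false] <;> linarith
  · rw [vonMangoldt.residueClass, Set.indicator_of_notMem (by exact ha)]
    have : 0 ≤ Real.log n := hΛ.trans hlog
    split_ifs <;> linarith

lemma sum_card_le_beiterCount {p : ℕ} (hp : p.Prime) (n : ℕ) :
    ∑ β ∈ Bset p, ((Finset.Icc 1 n).filter fun k : ℕ =>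
      k.Prime ∧ p * p < k ∧ (k : ZMod p) = (β : ZMod p)).card ≤ beiterCount p n := by
  have hlt : ∀ β ∈ Bset p, β < p := by
    intro β hβ
    simp only [Bset, Bminus, Bplus, Finset.mem_union, Finset.mem_filter] at hβ
    omega
  rw [← Finset.card_biUnion, beiterCount, ← Set.ncard_coe_finset]
  · refine Set.ncard_le_ncard ?_ ((Set.finite_Iic n).subset fun q hq => hq.2.1)
    intro q hq
    simp only [Finset.coe_biUnion, Set.mem_iUnion, Finset.mem_coe, Finset.mem_filter,
      Finset.mem_Icc] at hq
    obtain ⟨β, hβ, hqn, hq, hpq, hqβ⟩ := hq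
    exact ⟨(Nat.le_mul_self p).trans_lt hpq, hqn.2, hq,
      exists_cycHeight_gt hp hq hpq hβ ((ZMod.natCast_eq_natCast_iff _ _ _).1 hqβ)⟩
  · intro β hβ γ hγ hne
    refine Finset.disjoint_left.2 fun k hk hk' => hne ?_
    have h1 := (Finset.mem_filter.1 hk).2.2.2
    have h2 := (Finset.mem_filter.1 hk').2.2.2
    rw [h1, ZMod.natCast_eq_natCast_iff] at h2
    exact h2.eq_of_lt_of_lt (hlt β hβ) (hlt γ hγ)

lemma beiterCount_le_primeCounting (p n : ℕ) : beiterCount p n ≤ Nat.primeCounting n := by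
  rw [← Nat.primesLE_card_eq_primeCounting, ← Set.ncard_coe_finset, beiterCount]
  refine Set.ncard_le_ncard (fun q hq => ?_) (Finset.finite_toSet _)
  simp only [Finset.mem_coe, Nat.mem_primesLE]
  exact ⟨hq.2.1, hq.2.2.1⟩

/-- The lower density bound, for the counting function along the natural numbers. -/
lemma card_Bset_div_le_liminf (p : ℕ) (hp : p.Prime) :
    ((Bset p).card : ℝ) / ((p : ℝ) - 1) ≤
      Filter.liminf
        (fun x : ℕ => (beiterCount p x : ℝ) / (Nat.primeCounting x : ℝ))
        Filter.atTop := by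
  have := Fact.mk hp
  have hunit : ∀ β ∈ Bset p, IsUnit (β : ZMod p) := by
    intro β hβ
    have hβ' : 1 ≤ β ∧ β < p := by
      simp only [Bset, Bminus, Bplus, Finset.mem_union, Finset.mem_filter, Finset.mem_Icc] at hβ
      omega
    rw [isUnit_iff_ne_zero, Ne, ZMod.natCast_eq_zero_iff]
    exact Nat.not_dvd_of_pos_of_lt hβ'.1 hβ'.2
  have h1 : Tendsto (fun n : ℕ => ∑ β ∈ Bset p,
      ((∑ k ∈ Finset.Icc 1 n, vonMangoldt.residueClass (β : ZMod p) k) / n - (ψ n - θ n) / n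
        - ψ (p * p : ℕ) / n)) atTop (𝓝 (∑ β ∈ Bset p, ((p : ℝ) - 1)⁻¹)) := by
    refine tendsto_finsetSum _ fun β hβ => ?_
    have e1 := ((tendsto_sum_residueClass_div (hunit β hβ)).sub tendsto_psi_sub_theta_div).sub
      (tendsto_natCast_atTop_atTop.const_div_atTop (ψ (p * p : ℕ)))
    rwa [Nat.totient_prime hp, Nat.cast_pred hp.pos, sub_zero, sub_zero] at e1
  have h2 := h1.div tendsto_primeCounting_mul_log_div one_ne_zero
  rw [Finset.sum_const, nsmul_eq_mul, div_one, ← div_eq_mul_inv] at h2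
  rw [← h2.liminf_eq]
  refine liminf_le_liminf ?_ h2.isBoundedUnder_ge ?_
  · filter_upwards [eventually_gt_atTop 1] with n hn
    have hn0 : (0 : ℝ) < n := by exact_mod_cast one_pos.trans hn
    have hlog : 0 < Real.log n := Real.log_pos (by exact_mod_cast hn)
    have hle : ∑ β ∈ Bset p, ((∑ k ∈ Finset.Icc 1 n,
        vonMangoldt.residueClass (β : ZMod p) k) / n - (ψ n - θ n) / n - ψ (p * p : ℕ) / n) ≤
        beiterCount p n * Real.log n / n := by
      refine le_trans (Finset.sum_le_sum fun β _ => ?_) (b := ∑ β ∈ Bset p,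
        ((Finset.Icc 1 n).filter fun k : ℕ =>
          k.Prime ∧ p * p < k ∧ (k : ZMod p) = (β : ZMod p)).card * Real.log n / n) ?_
      · rw [← sub_div, ← sub_div]
        gcongr
        linarith [sum_residueClass_le (β : ZMod p) (p * p) n]
      · rw [← Finset.sum_div, ← Finset.sum_mul, ← Nat.cast_sum]
        gcongr
        exact sum_card_le_beiterCount hp n
    simp only [Pi.div_apply]
    calc _ ≤ beiterCount p n * Real.log n / n / (Nat.primeCounting n * Real.log n / n) := by
          gcongr
      _ = _ := by field_simp
  · refine IsBoundedUnder.isCoboundedUnder_ge ⟨1, eventually_map.2 (Eventually.of_forall ?_)⟩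
    intro n
    exact div_le_one_of_le₀ (by exact_mod_cast beiterCount_le_primeCounting p n)
      (Nat.cast_nonneg _)

end PrimeNumberTheorem

theorem stmt_11 (p : ℕ) (hp : p.Prime) :
    ((Bset p).card : ℝ) / ((p : ℝ) - 1) ≤
      Filter.liminf
        (fun x : ℕ => (beiterCount p x : ℝ) / (Nat.primeCounting x : ℝ))
        Filter.atTop :=
  card_Bset_div_le_liminf p hp
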